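/- arXiv:0908.3267 — 2 statements merged into one kernel-verified Lean document; each statement's English description precedes it below -/
import Mathlib

section
/- Let A be a field which is a unital complex *-algebra (a ℂ-algebra with conjugate-linear star operation), and suppose A is different from ℂ in the sense that the algebra map ℂ → A is not surjective. Then every positive linear functional on A is zero: if φ : A → ℂ is ℂ-linear and φ(star a * a) is a nonnegative real for every a ∈ A, then φ = 0. -/
open Polynomial in
/-- A polynomial nonnegative on `ℝ`, evaluated at a self-adjoint element `t`, is nonnegative under
every positive functional, even when weighted by a hermitian square. -/
theorem nonneg_of_polynomial_nonneg {A : Type*} [Field A] [Algebra ℝ A] [StarRing A]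
    [StarModule ℝ A] (L : A →ₗ[ℝ] ℝ) (hL : ∀ a, 0 ≤ L (star a * a)) {t : A} (ht : star t = t)
    (P : ℝ[X]) (hP : ∀ x, 0 ≤ P.eval x) (b : A) : 0 ≤ L (star b * b * aeval t P) := by
  induction hn : P.natDegree using Nat.strong_induction_on generalizing P b with
  | _ n ih =>
  obtain ⟨p, hp⟩ := P.exists_forall_norm_le
  have hmin : ∀ y, P.eval p ≤ P.eval y := fun y => by
    simpa [abs_of_nonneg, hP] using hp y
  obtain ⟨H, hH⟩ : (X - C p) ∣ P - C (P.eval p) := X_sub_C_dvd_sub_C_eval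
  have hH0 : H.eval p = 0 := by
    have hd : deriv (fun x => P.eval x) p = 0 :=
      IsLocalMin.deriv_eq_zero (Filter.Eventually.of_forall hmin)
    rw [Polynomial.deriv] at hd
    have := congrArg (fun Q : ℝ[X] => (derivative Q).eval p) hH
    simpa [hd] using this.symm
  obtain ⟨G, rfl⟩ := dvd_iff_isRoot.2 hH0
  have hPG : P = C (P.eval p) + (X - C p) ^ 2 * G := by linear_combination hH
  have hG0 : ∀ x, x ≠ p → 0 ≤ G.eval x := fun x hx => by
    have h1 := hmin x
    have h2 := congrArg (eval x) hPG
    simp only [eval_add, eval_mul, eval_pow, eval_sub, eval_X, eval_C] at h2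
    have h3 : 0 < (x - p) ^ 2 := by have := sub_ne_zero.2 hx; positivity
    exact nonneg_of_mul_nonneg_right (by linarith) h3
  have hG : ∀ x, 0 ≤ G.eval x := by
    have hcl : IsClosed {x | 0 ≤ G.eval x} := isClosed_le continuous_const G.continuous
    have hd : Dense {p}ᶜ := dense_compl_singleton (p : ℝ)
    intro x
    exact hcl.closure_subset_iff.2 (fun y hy => hG0 y hy) (hd x)
  have hconst : 0 ≤ L (star b * b * aeval t (C (P.eval p))) := by
    rw [aeval_C, mul_comm, ← Algebra.smul_def, map_smul]
    exact mul_nonneg (hP p) (hL b)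
  by_cases hGz : G = 0
  · rw [hPG, hGz]; simpa using hconst
  have hdeg : G.natDegree < n := by
    have h1 : (P - C (P.eval p)).natDegree = 1 + (1 + G.natDegree) := by
      rw [hH, natDegree_mul (X_sub_C_ne_zero p) (mul_ne_zero (X_sub_C_ne_zero p) hGz),
        natDegree_mul (X_sub_C_ne_zero p) hGz, natDegree_X_sub_C]
    rw [natDegree_sub_C] at h1
    omega
  have := ih _ hdeg G hG (b * (t - algebraMap ℝ A p)) rfl
  have hs : star (algebraMap ℝ A p) = algebraMap ℝ A p := by
    rw [← algebraMap_star_comm]; simp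
  rw [hPG, map_add, mul_add, map_add]
  refine add_nonneg hconst (this.trans_eq (congrArg L ?_))
  simp only [star_mul', star_sub, ht, hs, map_mul, map_pow, map_sub, aeval_X, aeval_C]
  ring

open Polynomial in
theorem star_aeval_of_star_eq {A : Type*} [CommRing A] [Algebra ℝ A] [StarRing A]
    [StarModule ℝ A] {t : A} (ht : star t = t) (P : ℝ[X]) : star (aeval t P) = aeval t P := by
  induction P using Polynomial.induction_on' with
  | add p q hp hq => simp [hp, hq]
  | monomial n a => simp [aeval_monomial, ht, ← algebraMap_star_comm]

open Polynomial in
theorem nonneg_of_polynomial_div_nonneg {A : Type*} [Field A] [Algebra ℝ A] [StarRing A]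
    [StarModule ℝ A] (L : A →ₗ[ℝ] ℝ) (hL : ∀ a, 0 ≤ L (star a * a)) {t : A} (ht : star t = t)
    (P Q : ℝ[X]) (h : ∀ x, 0 ≤ P.eval x * Q.eval x) :
    0 ≤ L (aeval t P / aeval t Q) := by
  have := nonneg_of_polynomial_nonneg L hL ht (P * Q) (by simpa using h) (aeval t Q)⁻¹
  refine this.trans_eq (congrArg L ?_)
  rw [star_inv₀, star_aeval_of_star_eq ht, map_mul]
  by_cases hQ : aeval t Q = 0
  · simp [hQ]
  · field_simp

open Polynomial in
theorem aeval_ne_zero_of_eval_pos {A : Type*} [Ring A] [Algebra ℝ A] {t : A}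
    (ht : Transcendental ℝ t) {Q : ℝ[X]} (hQ : ∀ x, 0 < Q.eval x) : aeval t Q ≠ 0 := fun h => by
  simpa [transcendental_iff.1 ht Q h] using hQ 0

open Polynomial in
/-- `c` bounds the value of `L` at some rational function of `t` which is nonnegative on `ℝ` and
at least `1` on `E`; so `c` bounds from above the mass of `E`. -/
def IsMassBound {A : Type*} [Field A] [Algebra ℝ A] (L : A →ₗ[ℝ] ℝ) (t : A) (c : ℝ)
    (E : Set ℝ) : Prop :=
  ∃ P Q : ℝ[X], (∀ x, 0 < Q.eval x) ∧ (∀ x, 0 ≤ P.eval x) ∧ (∀ x ∈ E, Q.eval x ≤ P.eval x) ∧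
    L (aeval t P / aeval t Q) ≤ c

namespace IsMassBound

open Polynomial

variable {A : Type*} [Field A] [Algebra ℝ A] {L : A →ₗ[ℝ] ℝ} {t : A}

theorem mono {c d : ℝ} {E F : Set ℝ} (h : IsMassBound L t c E) (hcd : c ≤ d) (hF : F ⊆ E) :
    IsMassBound L t d F := by
  obtain ⟨P, Q, hQ, hP, hE, hc⟩ := h
  exact ⟨P, Q, hQ, hP, fun x hx => hE x (hF hx), hc.trans hcd⟩

theorem empty : IsMassBound L t 0 ∅ :=
  ⟨0, 1, by simp, by simp, by simp, by simp⟩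

theorem union (ht : Transcendental ℝ t) {c d : ℝ} {E F : Set ℝ} (hE : IsMassBound L t c E)
    (hF : IsMassBound L t d F) : IsMassBound L t (c + d) (E ∪ F) := by
  obtain ⟨P, Q, hQ, hP, hPQ, hc⟩ := hE
  obtain ⟨P', Q', hQ', hP', hPQ', hd⟩ := hF
  refine ⟨P * Q' + P' * Q, Q * Q', fun x => ?_, fun x => ?_, fun x hx => ?_, ?_⟩
  · simpa using mul_pos (hQ x) (hQ' x)
  · have := mul_nonneg (hP x) (hQ' x).le
    have := mul_nonneg (hP' x) (hQ x).le
    simp only [eval_add, eval_mul]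
    linarith
  · have h1 := mul_nonneg (hP x) (hQ' x).le
    have h2 := mul_nonneg (hP' x) (hQ x).le
    simp only [eval_add, eval_mul]
    rcases hx with hx | hx
    · nlinarith [mul_le_mul_of_nonneg_right (hPQ x hx) (hQ' x).le]
    · nlinarith [mul_le_mul_of_nonneg_right (hPQ' x hx) (hQ x).le]
  · have h1 := aeval_ne_zero_of_eval_pos ht hQ
    have h2 := aeval_ne_zero_of_eval_pos ht hQ'
    have : aeval t (P * Q' + P' * Q) / aeval t (Q * Q') =
        aeval t P / aeval t Q + aeval t P' / aeval t Q' := by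
      simp only [map_add, map_mul]
      field_simp
    rw [this, map_add]
    exact add_le_add hc hd

theorem far {R : ℝ} (hR : 0 < R) :
    IsMassBound L t (L (t ^ 2) / R ^ 2) (Set.Ico (-R) R)ᶜ := by
  refine ⟨X ^ 2, C (R ^ 2), fun x => ?_, fun x => ?_, fun x hx => ?_, ?_⟩
  · simp; positivity
  · simp; positivity
  · simp only [Set.mem_compl_iff, Set.mem_Ico, not_and_or, not_le, not_lt] at hx
    simp only [eval_pow, eval_X, eval_C]
    rcases hx with hx | hx <;> nlinarith
  · rw [map_pow, aeval_X, aeval_C, div_eq_inv_mul, ← map_inv₀, ← Algebra.smul_def, map_smul,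
      smul_eq_mul, ← div_eq_inv_mul]

variable [StarRing A] [StarModule ℝ A]

theorem le_of_univ (hL : ∀ a, 0 ≤ L (star a * a)) (ht : star t = t) (htr : Transcendental ℝ t)
    {c : ℝ} (h : IsMassBound L t c Set.univ) : L 1 ≤ c := by
  obtain ⟨P, Q, hQ, hP, hPQ, hc⟩ := h
  have hne := aeval_ne_zero_of_eval_pos htr hQ
  have := nonneg_of_polynomial_div_nonneg L hL ht (P - Q) Q fun x => by
    simpa using mul_nonneg (sub_nonneg.2 (hPQ x trivial)) (hQ x).le
  rw [map_sub, sub_div, div_self hne, map_sub] at this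
  linarith

/-- The mass near a point `p` is at most quadratic in the radius. -/
theorem near (hL : ∀ a, 0 ≤ L (star a * a)) (ht : star t = t) (htr : Transcendental ℝ t)
    (p : ℝ) {r : ℝ} (hr : 0 < r) :
    IsMassBound L t (2 * r ^ 2 * L (1 / (aeval t (X - C p)) ^ 2)) (Set.Icc (p - r) (p + r)) := by
  refine ⟨C (2 * r ^ 2), (X - C p) ^ 2 + C (r ^ 2), fun x => ?_, fun x => ?_, fun x hx => ?_, ?_⟩
  · simp; positivity
  · simp; positivity
  · simp only [eval_add, eval_pow, eval_sub, eval_X, eval_C]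
    nlinarith [hx.1, hx.2]
  · have h1 : aeval t (X - C p) ≠ 0 := fun h =>
      X_sub_C_ne_zero p ((transcendental_iff.1 htr) _ h)
    have h2 : aeval t ((X - C p) ^ 2 + C (r ^ 2)) ≠ 0 := fun h => by
      have := congrArg (eval p) ((transcendental_iff.1 htr) _ h)
      simp [hr.ne'] at this
    have h3 := nonneg_of_polynomial_div_nonneg L hL ht (C (2 * r ^ 2) * C (r ^ 2))
      ((X - C p) ^ 2 * ((X - C p) ^ 2 + C (r ^ 2))) fun x => by simp; positivity
    rw [← smul_eq_mul (2 * r ^ 2), ← map_smul, ← sub_nonneg, ← map_sub]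
    refine h3.trans_eq (congrArg L ?_)
    simp only [map_add, map_pow, aeval_C] at h2
    simp only [Algebra.smul_def, map_mul, map_pow, map_add, aeval_C]
    field_simp
    ring

theorem Ico (hL : ∀ a, 0 ≤ L (star a * a)) (ht : star t = t) (htr : Transcendental ℝ t)
    {ε : ℝ} (hε : 0 < ε) {a b : ℝ} (hab : a ≤ b) :
    IsMassBound L t (ε * (b - a)) (Set.Ico a b) := by
  have hloc (s : ℝ) : ∃ δ > 0, ∀ x y, x ≤ s → s ≤ y → x < y → y - x ≤ δ →
      IsMassBound L t (ε * (y - x)) (Set.Ico x y) := by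
    set K := L (1 / (aeval t (X - C s)) ^ 2)
    refine ⟨ε / (2 * (|K| + 1)), by positivity, fun x y hx hy hxy hδ => ?_⟩
    refine (near hL ht htr s (sub_pos.2 hxy)).mono ?_ fun z hz => ⟨?_, ?_⟩
    · rw [le_div_iff₀ (by positivity)] at hδ
      have h1 : (y - x) * (2 * K) ≤ ε := by
        refine le_trans (mul_le_mul_of_nonneg_left ?_ (sub_pos.2 hxy).le) hδ
        linarith [le_abs_self K]
      nlinarith [mul_le_mul_of_nonneg_left h1 (sub_pos.2 hxy).le]
    · linarith [hz.1]
    · linarith [hz.2]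
  set S := {x | x ∈ Set.Icc a b ∧ IsMassBound L t (ε * (x - a)) (Set.Ico a x)}
  have haS : a ∈ S := ⟨⟨le_rfl, hab⟩, by simpa using empty⟩
  have hbdd : BddAbove S := ⟨b, fun x hx => hx.1.2⟩
  have has : a ≤ sSup S := le_csSup hbdd haS
  have hsb : sSup S ≤ b := csSup_le ⟨a, haS⟩ fun x hx => hx.1.2
  obtain ⟨δ, hδ, h⟩ := hloc (sSup S)
  obtain ⟨x, hxS, hx⟩ := exists_lt_of_lt_csSup ⟨a, haS⟩ (show sSup S - δ / 2 < sSup S by linarith)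
  have hxs : x ≤ sSup S := le_csSup hbdd hxS
  have key (y : ℝ) (hsy : sSup S ≤ y) (hyb : y ≤ b) (hyδ : y ≤ sSup S + δ / 2) : y ∈ S := by
    refine ⟨⟨has.trans hsy, hyb⟩, ?_⟩
    rcases (hxs.trans hsy).eq_or_lt with rfl | hxy
    · exact hxS.2
    · refine (union htr hxS.2 (h x y hxs hsy hxy (by linarith))).mono (by linarith) ?_
      rw [Set.Ico_union_Ico_eq_Ico hxS.1.1 hxy.le]
  have hmem := key (min b (sSup S + δ / 2)) (le_min hsb (by linarith)) (min_le_left _ _)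
    (min_le_right _ _)
  have hle := le_csSup hbdd hmem
  rcases min_le_iff.1 hle with hb | hb
  · exact (key b hsb le_rfl (by linarith)).2
  · linarith

end IsMassBound

/-- A positive functional on a field with an involution and a transcendental self-adjoint element
is nonpositive at `1`. -/
theorem map_one_nonpos_of_transcendental {A : Type*} [Field A] [Algebra ℝ A] [StarRing A]
    [StarModule ℝ A] (L : A →ₗ[ℝ] ℝ) (hL : ∀ a, 0 ≤ L (star a * a)) {t : A} (ht : star t = t)
    (htr : Transcendental ℝ t) : L 1 ≤ 0 := by
  by_contra! h1
  have ht2 : 0 ≤ L (t ^ 2) := by simpa [ht, sq] using hL t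
  set R := L (t ^ 2) / L 1 + 2
  have hR : 2 ≤ R := le_add_of_nonneg_left (by positivity)
  have hfar : L (t ^ 2) / R ^ 2 ≤ L 1 / 2 := by
    rw [div_le_iff₀ (by positivity)]
    have : L (t ^ 2) = (R - 2) * L 1 := by simp only [R]; field_simp; ring
    rw [this]
    nlinarith [mul_nonneg h1.le (sq_nonneg (R - 1))]
  have hnear := IsMassBound.Ico hL ht htr (ε := L 1 / (8 * R)) (by positivity)
    (show -R ≤ R by linarith)
  have := IsMassBound.union htr hnear (IsMassBound.far (L := L) (t := t) (by linarith : 0 < R))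
  rw [Set.union_compl_self] at this
  have h2 := this.le_of_univ hL ht htr
  have h3 : L 1 / (8 * R) * (R - -R) = L 1 / 4 := by field_simp; ring
  linarith

theorem mem_range_algebraMap_of_isAlgebraic {k A : Type*} [Field k] [IsAlgClosed k] [Field A]
    [Algebra k A] {x : A} (hx : IsAlgebraic k x) : x ∈ (algebraMap k A).range :=
  minpoly.mem_range_of_degree_eq_one k x <|
    IsAlgClosed.degree_eq_one_of_irreducible k (minpoly.irreducible hx.isIntegral)

theorem exists_star_eq_self_notMem_range {A : Type*} [Field A] [Algebra ℂ A] [StarRing A]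
    [StarModule ℂ A] (hA : ¬Function.Surjective (algebraMap ℂ A)) :
    ∃ t : A, star t = t ∧ t ∉ (algebraMap ℂ A).range := by
  by_contra! h
  refine hA fun x => ?_
  set i := algebraMap ℂ A Complex.I
  have hi : i * i = -1 := by simp [i, ← map_mul]
  have hsi : star i = -i := by simp [i, ← algebraMap_star_comm]
  obtain ⟨u, hu⟩ := h (x + star x) (by simp [add_comm])
  obtain ⟨v, hv⟩ := h (i * (x - star x)) (by simp only [star_mul', star_sub, hsi, star_star]; ring)
  refine ⟨(1 / 2) * (u - Complex.I * v), ?_⟩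
  have h2 : algebraMap ℂ A (1 / 2) * 2 = 1 := by
    rw [← map_ofNat (algebraMap ℂ A) 2, ← map_mul]; norm_num
  rw [map_mul, map_sub, map_mul, hu, hv]
  linear_combination x * h2 - algebraMap ℂ A (1 / 2) * (x - star x) * hi

theorem eq_zero_of_map_one_eq_zero {A : Type*} [Ring A] [Algebra ℂ A] [StarRing A]
    [StarModule ℂ A] (φ : A →ₗ[ℂ] ℂ)
    (hpos : ∀ a : A, ∃ r : ℝ, 0 ≤ r ∧ φ (star a * a) = (r : ℂ)) (h1 : φ 1 = 0) : φ = 0 := by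
  ext a
  have hz (z : ℂ) : ∃ r : ℝ, 0 ≤ r ∧
      φ (star a * a) + z * φ (star a) + starRingEnd ℂ z * φ a = r := by
    obtain ⟨r, hr, h⟩ := hpos (a + z • 1)
    refine ⟨r, hr, h ▸ ?_⟩
    simp only [star_add, star_smul, star_one, add_mul, mul_add, smul_mul_assoc, mul_smul_comm,
      one_mul, mul_one, map_add, map_smul, h1, smul_eq_mul, mul_zero, add_zero]
    rw [starRingEnd_apply]
    ring
  obtain ⟨c, hc, hca⟩ := hpos a
  rw [hca] at hz
  obtain ⟨r₁, -, e₁⟩ := hz 1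
  obtain ⟨r₂, -, e₂⟩ := hz Complex.I
  have hre : (φ (star a)).re = (φ a).re := by
    have := congrArg Complex.im e₂
    simp at this
    linarith
  have him : (φ (star a)).im = -(φ a).im := by
    have := congrArg Complex.im e₁
    simp at this
    linarith
  by_contra! hne
  have hn : 0 < (φ a).re ^ 2 + (φ a).im ^ 2 := by
    have := Complex.normSq_pos.2 hne
    rw [Complex.normSq_apply] at this
    linarith
  set n := (φ a).re ^ 2 + (φ a).im ^ 2
  obtain ⟨r, hr, e⟩ := hz ((-((c + 1) / n) : ℝ) * φ a)
  have e' := congrArg Complex.re e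
  simp only [map_mul, Complex.conj_ofReal, Complex.add_re, Complex.mul_re, Complex.mul_im,
    Complex.ofReal_re, Complex.ofReal_im, Complex.conj_re, Complex.conj_im, hre, him] at e'
  have : (c + 1) / n * n = c + 1 := div_mul_cancel₀ _ hn.ne'
  have : r = c - 2 * ((c + 1) / n * n) := by
    rw [← e']
    simp only [n]
    ring
  linarith

/-- A field which is a unital complex *-algebra different from `ℂ` (the algebra
map `ℂ → A` is not surjective) carries no nonzero positive linear functionals. -/
theorem stmt7 {A : Type*} [Field A] [Algebra ℂ A] [StarRing A] [StarModule ℂ A]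
    (hA : ¬Function.Surjective (algebraMap ℂ A))
    (φ : A →ₗ[ℂ] ℂ)
    (hpos : ∀ a : A, ∃ r : ℝ, 0 ≤ r ∧ φ (star a * a) = (r : ℂ)) :
    φ = 0 := by
  obtain ⟨t, ht, htA⟩ := exists_star_eq_self_notMem_range hA
  have htr : Transcendental ℝ t := fun h =>
    htA (mem_range_algebraMap_of_isAlgebraic (h.extendScalars Complex.ofReal_injective))
  have hle := map_one_nonpos_of_transcendental (Complex.reLm ∘ₗ φ.restrictScalars ℝ)
    (fun a => by obtain ⟨r, hr, h⟩ := hpos a; simpa [h] using hr) ht htr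
  obtain ⟨r, hr, h⟩ := hpos 1
  rw [star_one, one_mul] at h
  refine eq_zero_of_map_one_eq_zero φ hpos ?_
  have : r = 0 := le_antisymm (by simpa [h] using hle) hr
  simp [h, this]
end

section
/- (Bisgaard) Let A be a unital complex *-algebra and let φ be a positive linear functional on A. Then φ vanishes on the Jacobson radical of A: if a ∈ A satisfies that 1 + b*a is invertible for every b ∈ A (i.e. a belongs to the Jacobson radical, in Lean a ∈ (⊥ : Ideal A).jacobson), then φ(a) = 0. -/
open Polynomial in
/-- A real polynomial which is nonnegative on the real line is a sum of two squares. -/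
theorem exists_eq_sq_add_sq_of_eval_nonneg (p : ℝ[X]) (hp : ∀ x, 0 ≤ p.eval x) :
    ∃ f g : ℝ[X], p = f ^ 2 + g ^ 2 := by
  induction hn : p.natDegree using Nat.strong_induction_on generalizing p with
  | _ n ih =>
  subst hn
  by_cases hdeg : p.natDegree = 0
  · obtain ⟨c, rfl⟩ := natDegree_eq_zero.1 hdeg
    refine ⟨C √c, 0, ?_⟩
    have hc : 0 ≤ c := by simpa using hp 0
    rw [← C_pow, Real.sq_sqrt hc]
    simp
  have hp0 : p ≠ 0 := by
    rintro rfl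
    simp at hdeg
  -- nonnegativity passes to a cofactor of a nonzero nonnegative polynomial
  have key : ∀ d s : ℝ[X], p = d * s → (∀ x, 0 ≤ d.eval x) → ∀ x, 0 ≤ s.eval x := by
    intro d s hds hd x
    by_contra! hx
    have hd0 : d ≠ 0 := by
      rintro rfl
      exact hp0 (by simpa using hds)
    have hnhds : {y | s.eval y < 0} ∈ nhds x :=
      (isOpen_lt s.continuous continuous_const).mem_nhds hx
    have hsub : {y | s.eval y < 0} ⊆ {y | d.IsRoot y} := by
      intro y hy
      have h1 := hp y
      rw [hds, eval_mul] at h1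
      have h2 := hd y
      simp only [Set.mem_ofPred_eq] at hy
      exact le_antisymm (by by_contra! h; nlinarith) h2
    exact (infinite_of_mem_nhds x hnhds) ((finite_setOfPred_isRoot hd0).subset hsub)
  have step : ∀ d s : ℝ[X], p = d * s → (∀ x, 0 ≤ d.eval x) → d.natDegree ≠ 0 →
      (∃ f g : ℝ[X], d = f ^ 2 + g ^ 2) → ∃ f g : ℝ[X], p = f ^ 2 + g ^ 2 := by
    rintro d s hds hd hdd ⟨f₁, g₁, h₁⟩
    have hlt : s.natDegree < p.natDegree := by
      have h := hp0
      rw [hds] at h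
      rw [hds, natDegree_mul (left_ne_zero_of_mul h) (right_ne_zero_of_mul h)]
      omega
    obtain ⟨f₂, g₂, h₂⟩ := ih _ hlt s (key d s hds hd) rfl
    exact ⟨f₁ * f₂ - g₁ * g₂, f₁ * g₂ + g₁ * f₂, by rw [hds, h₁, h₂]; ring⟩
  obtain ⟨z, hz⟩ := IsAlgClosed.exists_aeval_eq_zero ℂ p
    (fun h => hdeg (natDegree_eq_of_degree_eq_some h))
  by_cases him : z.im = 0
  · have hroot : p.IsRoot z.re := by
      have hz' : z = algebraMap ℝ ℂ z.re := by
        apply Complex.ext <;> simp [him]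
      rw [hz', aeval_algebraMap_apply] at hz
      simpa using hz
    obtain ⟨r, hr⟩ := dvd_iff_isRoot.2 hroot
    have hr0 : r.IsRoot z.re := by
      have hcont := r.continuous
      apply le_antisymm
      · by_contra! h
        obtain ⟨ε, hε, hb⟩ := Metric.isOpen_iff.1
          (isOpen_lt continuous_const hcont : IsOpen {y | 0 < r.eval y}) z.re h
        have hy : z.re - ε / 2 ∈ Metric.ball z.re ε := by
          rw [Metric.mem_ball, Real.dist_eq, abs_lt]
          constructor <;> linarith
        have h1 := hb hy
        have h2 := hp (z.re - ε / 2)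
        simp only [Set.mem_ofPred_eq] at h1
        simp only [hr, eval_mul, eval_sub, eval_X, eval_C] at h2
        nlinarith
      · by_contra! h
        obtain ⟨ε, hε, hb⟩ := Metric.isOpen_iff.1
          (isOpen_lt hcont continuous_const : IsOpen {y | r.eval y < 0}) z.re h
        have hy : z.re + ε / 2 ∈ Metric.ball z.re ε := by
          rw [Metric.mem_ball, Real.dist_eq, abs_lt]
          constructor <;> linarith
        have h1 := hb hy
        have h2 := hp (z.re + ε / 2)
        simp only [Set.mem_ofPred_eq] at h1
        simp only [hr, eval_mul, eval_sub, eval_X, eval_C] at h2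
        nlinarith
    obtain ⟨s, hs⟩ := dvd_iff_isRoot.2 hr0
    refine step ((X - C z.re) ^ 2) s (by rw [hr, hs]; ring) ?_ ?_ ⟨X - C z.re, 0, by ring⟩
    · intro x
      simpa using sq_nonneg _
    · simp
  · obtain ⟨s, hs⟩ := p.quadratic_dvd_of_aeval_eq_zero_im_ne_zero hz him
    have hsq : (X ^ 2 - C (2 * z.re) * X + C (‖z‖ ^ 2) : ℝ[X])
        = (X - C z.re) ^ 2 + C z.im ^ 2 := by
      rw [Complex.sq_norm, Complex.normSq_apply]
      simp only [C_mul, C_add, C_ofNat]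
      ring
    refine step _ s hs ?_ ?_ ⟨_, _, hsq⟩
    · intro x
      rw [hsq]
      simp only [eval_add, eval_pow, eval_sub, eval_X, eval_C]
      positivity
    · have : (X ^ 2 - C (2 * z.re) * X + C (‖z‖ ^ 2) : ℝ[X]).natDegree = 2 := by
        compute_degree!
      omega

/-- **Cousin's lemma** for additive interval predicates: a predicate that is stable under
concatenation of intervals and holds for small intervals around each point holds everywhere. -/
theorem Real.interval_induction {P : ℝ → ℝ → Prop}
    (hadd : ∀ u v w, u ≤ v → v ≤ w → P u v → P v w → P u w)
    (hloc : ∀ t, ∃ δ > 0, ∀ u v, u ≤ t → t ≤ v → v - u < δ → P u v)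
    {a b : ℝ} (hab : a ≤ b) : P a b := by
  set S := {x | a ≤ x ∧ x ≤ b ∧ P a x}
  have haS : a ∈ S := by
    obtain ⟨δ, hδ, h⟩ := hloc a
    exact ⟨le_rfl, hab, h a a le_rfl le_rfl (by simpa using hδ)⟩
  have hbdd : BddAbove S := ⟨b, fun x hx => hx.2.1⟩
  have hsb : sSup S ≤ b := csSup_le ⟨a, haS⟩ fun x hx => hx.2.1
  obtain ⟨δ, hδ, h⟩ := hloc (sSup S)
  obtain ⟨u, hu, hus⟩ := exists_lt_of_lt_csSup ⟨a, haS⟩ (show sSup S - δ / 2 < sSup S by linarith)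
  have hule : u ≤ sSup S := le_csSup hbdd hu
  have hle : sSup S ≤ min b (sSup S + δ / 3) := le_min hsb (by linarith)
  have hmin : min b (sSup S + δ / 3) ≤ sSup S + δ / 3 := min_le_right _ _
  have hP := hadd a u _ hu.1 (hule.trans hle) hu.2.2 (h u _ hule hle (by linarith))
  have hmem : min b (sSup S + δ / 3) ∈ S :=
    ⟨hu.1.trans (hule.trans hle), min_le_left _ _, hP⟩
  have hle' := le_csSup hbdd hmem
  rcases min_choice b (sSup S + δ / 3) with hb | hb
  · rwa [hb] at hP
  · rw [hb] at hle'
    linarith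

/-- Elements of the Jacobson radical are quasi-regular, also in noncommutative rings. -/
theorem Ideal.isUnit_one_add_of_mem_jacobson_bot {R : Type*} [Ring R] {x : R}
    (hx : x ∈ (⊥ : Ideal R).jacobson) : IsUnit (1 + x) := by
  have left : ∀ y ∈ (⊥ : Ideal R).jacobson, ∃ z, z * (1 + y) = 1 := by
    intro y hy
    obtain ⟨z, hz⟩ := Ideal.exists_mul_add_sub_mem_of_mem_jacobson y hy
    exact ⟨z, by rw [add_comm]; exact sub_eq_zero.1 ((Submodule.mem_bot R).1 hz)⟩
  obtain ⟨z, hz⟩ := left x hx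
  obtain ⟨w, hw⟩ := left (-(z * x)) (neg_mem (Ideal.mul_mem_left _ z hx))
  have hz' : 1 + -(z * x) = z := by
    rw [← hz]
    noncomm_ring
  rw [hz'] at hw
  have hwx : w = 1 + x := left_inv_eq_right_inv hw hz
  exact ⟨⟨1 + x, z, hwx ▸ hw, hz⟩, rfl⟩

/-- The Jacobson radical of a star ring is stable under the involution. -/
theorem Ideal.star_mem_jacobson_bot {R : Type*} [Ring R] [StarRing R] {x : R}
    (hx : x ∈ (⊥ : Ideal R).jacobson) : star x ∈ (⊥ : Ideal R).jacobson := by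
  rw [Ideal.mem_jacobson_iff]
  intro y
  have h := (Ideal.isUnit_one_add_of_mem_jacobson_bot
    (Ideal.mul_mem_right (star y) _ hx)).star
  obtain ⟨z, hz⟩ := h.exists_left_inv
  refine ⟨z, ?_⟩
  rw [Submodule.mem_bot, sub_eq_zero, ← hz]
  simp [mul_add, mul_assoc, add_comm]

section RealFunctional

open Polynomial

variable {A : Type*} [Ring A] [Algebra ℝ A]

/-- `RationalMajorant L h s c` says that some rational function `p / q ^ 2` in `h` (with value
`v` in the algebra) which is nonnegative, and at least `x ^ 2` for `x ∈ s`, satisfies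
`L v ≤ c`. -/
def RationalMajorant (L : A →ₗ[ℝ] ℝ) (h : A) (s : Set ℝ) (c : ℝ) : Prop :=
  ∃ (p q : ℝ[X]) (v : A), q.eval 0 ≠ 0 ∧ v * aeval h q ^ 2 = aeval h p ∧
    (∀ x, 0 ≤ p.eval x) ∧ (∀ x ∈ s, x ^ 2 * q.eval x ^ 2 ≤ p.eval x) ∧ L v ≤ c

namespace RationalMajorant

variable {L : A →ₗ[ℝ] ℝ} {h : A} {s t : Set ℝ} {c d : ℝ}

theorem mono (hs : RationalMajorant L h s c) (hts : t ⊆ s) (hcd : c ≤ d) :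
    RationalMajorant L h t d := by
  obtain ⟨p, q, v, hq, hv, hp, hpq, hc⟩ := hs
  exact ⟨p, q, v, hq, hv, hp, fun x hx => hpq x (hts hx), hc.trans hcd⟩

theorem union (hs : RationalMajorant L h s c) (ht : RationalMajorant L h t d) :
    RationalMajorant L h (s ∪ t) (c + d) := by
  obtain ⟨p₁, q₁, v₁, hq₁, hv₁, hp₁, hpq₁, hc₁⟩ := hs
  obtain ⟨p₂, q₂, v₂, hq₂, hv₂, hp₂, hpq₂, hc₂⟩ := ht
  refine ⟨p₁ * q₂ ^ 2 + p₂ * q₁ ^ 2, q₁ * q₂, v₁ + v₂, ?_, ?_, ?_, ?_, ?_⟩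
  · rw [eval_mul]
    exact mul_ne_zero hq₁ hq₂
  · have h₁ : aeval h (q₁ * q₂) ^ 2 = aeval h q₁ ^ 2 * aeval h q₂ ^ 2 := by
      simp only [← map_pow, ← map_mul]
      congr 1
      ring
    have h₂ : aeval h (q₁ * q₂) ^ 2 = aeval h q₂ ^ 2 * aeval h q₁ ^ 2 := by
      simp only [← map_pow, ← map_mul]
      congr 1
      ring
    rw [add_mul]
    nth_rewrite 1 [h₁]
    rw [h₂, ← mul_assoc, ← mul_assoc, hv₁, hv₂]
    simp only [map_add, map_mul, map_pow]
  · intro x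
    have := hp₁ x
    have := hp₂ x
    simp only [eval_add, eval_mul, eval_pow]
    positivity
  · rintro x hx
    simp only [eval_add, eval_mul, eval_pow]
    have h1 := mul_nonneg (hp₁ x) (sq_nonneg (q₂.eval x))
    have h2 := mul_nonneg (hp₂ x) (sq_nonneg (q₁.eval x))
    rcases hx with hx | hx
    · have := mul_le_mul_of_nonneg_right (hpq₁ x hx) (sq_nonneg (q₂.eval x))
      nlinarith
    · have := mul_le_mul_of_nonneg_right (hpq₂ x hx) (sq_nonneg (q₁.eval x))
      nlinarith
  · rw [map_add]
    exact add_le_add hc₁ hc₂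

end RationalMajorant

theorem isUnit_aeval_of_mem_jacobson {h : A} (hh : h ∈ (⊥ : Ideal A).jacobson) {q : ℝ[X]}
    (hq : q.eval 0 ≠ 0) : IsUnit (aeval h q) := by
  have hdecomp : q = C (q.eval 0) * (1 + C (q.eval 0)⁻¹ * q.divX * X) := by
    have h1 : C (q.eval 0) * C (q.eval 0)⁻¹ = (1 : ℝ[X]) := by
      rw [← C_mul, mul_inv_cancel₀ hq, C_1]
    have h2 := q.divX_mul_X_add
    rw [coeff_zero_eq_eval_zero] at h2
    linear_combination -h2 - q.divX * X * h1
  rw [hdecomp, map_mul, aeval_C]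
  refine ((IsUnit.mk0 _ hq).map (algebraMap ℝ A)).mul ?_
  rw [map_add, map_one, map_mul, aeval_X]
  exact Ideal.isUnit_one_add_of_mem_jacobson_bot (Ideal.mul_mem_left _ _ hh)

theorem exists_rationalMajorant_Icc (L : A →ₗ[ℝ] ℝ) {h : A} (hh : h ∈ (⊥ : Ideal A).jacobson)
    (t : ℝ) : ∃ C : ℝ, ∀ ε ≥ 0, RationalMajorant L h (Set.Icc (t - ε) (t + ε)) (C * ε ^ 2) := by
  by_cases ht : t = 0
  · subst ht
    refine ⟨L 1, fun ε hε => ⟨C (ε ^ 2), 1, ε ^ 2 • 1, by simp, ?_, ?_, ?_, ?_⟩⟩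
    · rw [aeval_C, Algebra.algebraMap_eq_smul_one]
      simp
    · intro x
      simpa using sq_nonneg ε
    · rintro x ⟨h1, h2⟩
      simp only [eval_one, eval_C]
      nlinarith
    · rw [map_smul, smul_eq_mul, mul_comm]
  · have hq : (X - C t : ℝ[X]).eval 0 ≠ 0 := by simpa using ht
    obtain ⟨u, hu⟩ := ((isUnit_aeval_of_mem_jacobson hh hq).pow 2).exists_left_inv
    refine ⟨L (h ^ 2 * u), fun ε hε =>
      ⟨C (ε ^ 2) * X ^ 2, X - C t, ε ^ 2 • (h ^ 2 * u), hq, ?_, ?_, ?_, ?_⟩⟩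
    · rw [smul_mul_assoc, mul_assoc, hu, mul_one, map_mul, aeval_C, map_pow (aeval h), aeval_X,
        Algebra.smul_def]
    · intro x
      simp only [eval_mul, eval_C, eval_pow, eval_X]
      positivity
    · rintro x ⟨h1, h2⟩
      simp only [eval_mul, eval_C, eval_pow, eval_X, eval_sub]
      have : (x - t) ^ 2 ≤ ε ^ 2 := sq_le_sq' (by linarith) (by linarith)
      nlinarith [sq_nonneg x]
    · rw [map_smul, smul_eq_mul, mul_comm]

theorem rationalMajorant_Icc (L : A →ₗ[ℝ] ℝ) {h : A} (hh : h ∈ (⊥ : Ideal A).jacobson)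
    {η : ℝ} (hη : 0 < η) {a b : ℝ} (hab : a ≤ b) :
    RationalMajorant L h (Set.Icc a b) (η * (b - a)) := by
  refine Real.interval_induction
    (P := fun a b => RationalMajorant L h (Set.Icc a b) (η * (b - a))) ?_ ?_ hab
  · intro u v w huv hvw h₁ h₂
    refine (h₁.union h₂).mono ?_ (by linarith)
    rw [Set.Icc_union_Icc_eq_Icc huv hvw]
  · intro t
    obtain ⟨C, hC⟩ := exists_rationalMajorant_Icc L hh t
    refine ⟨η / (|C| + 1), by positivity, fun u v hu hv huv => ?_⟩
    refine (hC (v - u) (by linarith)).mono (Set.Icc_subset_Icc (by linarith) (by linarith)) ?_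
    have h1 : (v - u) * (|C| + 1) < η := (lt_div_iff₀ (by positivity)).1 huv
    have h2 : C * (v - u) ≤ |C| * (v - u) :=
      mul_le_mul_of_nonneg_right (le_abs_self C) (by linarith)
    have h3 : C * (v - u) ≤ η := by nlinarith
    nlinarith [mul_le_mul_of_nonneg_right h3 (show 0 ≤ v - u by linarith)]

theorem rationalMajorant_tail (L : A →ₗ[ℝ] ℝ) (h : A) {N : ℝ} (hN : 0 < N) :
    RationalMajorant L h {x | N ≤ |x|} (L (h ^ 4) / N ^ 2) := by
  refine ⟨C (N ^ 2)⁻¹ * X ^ 4, 1, (N ^ 2)⁻¹ • h ^ 4, by simp, ?_, ?_, ?_, ?_⟩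
  · rw [map_one, one_pow, mul_one, map_mul, aeval_C, map_pow (aeval h), aeval_X, Algebra.smul_def]
  · intro x
    simp only [eval_mul, eval_C, eval_pow, eval_X]
    positivity
  · intro x hx
    simp only [eval_mul, eval_C, eval_pow, eval_X, eval_one]
    have h1 : N ^ 2 ≤ x ^ 2 := by
      rw [← sq_abs x]
      exact pow_le_pow_left₀ hN.le hx 2
    rw [inv_mul_eq_div, le_div_iff₀ (by positivity)]
    nlinarith [sq_nonneg x]
  · rw [map_smul, smul_eq_mul, inv_mul_eq_div]

variable [StarRing A] [StarModule ℝ A]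

theorem IsSelfAdjoint.aeval_real {h : A} (hh : IsSelfAdjoint h) (p : ℝ[X]) :
    IsSelfAdjoint (aeval h p) := by
  induction p using Polynomial.induction_on' with
  | add p q hp hq => simpa using hp.add hq
  | monomial n r =>
    rw [aeval_monomial, ← Algebra.smul_def]
    exact (IsSelfAdjoint.all r).smul (hh.pow n)

theorem RationalMajorant.apply_sq_le {L : A →ₗ[ℝ] ℝ}
    (hL : ∀ a, IsSelfAdjoint a → 0 ≤ L (a ^ 2)) {h : A} (hsa : IsSelfAdjoint h)
    (hh : h ∈ (⊥ : Ideal A).jacobson) {c : ℝ} (hc : RationalMajorant L h Set.univ c) :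
    L (h ^ 2) ≤ c := by
  obtain ⟨p, q, v, hq, hv, -, hpq, hc⟩ := hc
  obtain ⟨f, g, hfg⟩ := exists_eq_sq_add_sq_of_eval_nonneg (p - X ^ 2 * q ^ 2) (by
    intro x
    simpa using hpq x trivial)
  obtain ⟨u, hu⟩ := isUnit_aeval_of_mem_jacobson hh hq
  have hinv : IsSelfAdjoint (↑u⁻¹ : A) := by
    have hu' : star u = u := Units.ext (by rw [Units.coe_star, hu]; exact hsa.aeval_real q)
    rw [IsSelfAdjoint, ← Units.coe_star, star_inv, hu']
  have hcomm : ∀ r : ℝ[X], Commute (aeval h r) (↑u⁻¹ : A) := by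
    intro r
    refine Commute.units_inv_right ?_
    rw [hu]
    exact (Commute.all r q).map (aeval h)
  have hmul : (v - h ^ 2) * (u : A) ^ 2 = aeval h f ^ 2 + aeval h g ^ 2 := by
    rw [← map_pow, ← map_pow, ← map_add, ← hfg, sub_mul, hu, hv]
    simp
  have hsub : v - h ^ 2 = (aeval h f * ↑u⁻¹) ^ 2 + (aeval h g * ↑u⁻¹) ^ 2 := by
    rw [(hcomm f).mul_pow, (hcomm g).mul_pow, ← add_mul, ← hmul, mul_assoc,
      ← Units.val_pow_eq_pow_val, ← Units.val_pow_eq_pow_val, ← Units.val_mul]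
    simp
  have hsum : 0 ≤ L (v - h ^ 2) := by
    rw [hsub, map_add]
    exact add_nonneg
      (hL _ (((hsa.aeval_real f).commute_iff hinv).1 (hcomm f)))
      (hL _ (((hsa.aeval_real g).commute_iff hinv).1 (hcomm g)))
  rw [map_sub] at hsum
  linarith

theorem apply_sq_eq_zero_of_mem_jacobson {L : A →ₗ[ℝ] ℝ}
    (hL : ∀ a, IsSelfAdjoint a → 0 ≤ L (a ^ 2)) {h : A} (hsa : IsSelfAdjoint h)
    (hh : h ∈ (⊥ : Ideal A).jacobson) : L (h ^ 2) = 0 := by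
  refine le_antisymm (le_of_forall_pos_le_add fun e he => ?_) (hL h hsa)
  obtain ⟨N, hN1, hN⟩ : ∃ N : ℝ, 1 ≤ N ∧ (2 + |L (h ^ 4)|) / e ≤ N :=
    ⟨_, le_max_left _ _, le_max_right _ _⟩
  have hN0 : 0 < N := by linarith
  have hmaj := (rationalMajorant_Icc L hh (η := (N ^ 2)⁻¹) (by positivity)
    (show -N ≤ N by linarith)).union (rationalMajorant_tail L h hN0)
  have hle := (hmaj.mono (t := Set.univ) (fun x _ => ?_) le_rfl).apply_sq_le hL hsa hh
  · refine hle.trans ?_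
    rw [inv_mul_eq_div, ← add_div, zero_add, div_le_iff₀ (by positivity)]
    rw [div_le_iff₀ he] at hN
    nlinarith [le_abs_self (L (h ^ 4)), abs_nonneg (L (h ^ 4))]
  · rcases le_total N |x| with hx | hx
    · exact Or.inr hx
    · exact Or.inl (abs_le.1 hx)

/-- A real functional that is nonnegative on squares of self-adjoint elements vanishes on the
self-adjoint elements of the Jacobson radical. -/
theorem apply_eq_zero_of_isSelfAdjoint_of_mem_jacobson {L : A →ₗ[ℝ] ℝ}
    (hL : ∀ a, IsSelfAdjoint a → 0 ≤ L (a ^ 2)) {h : A} (hsa : IsSelfAdjoint h)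
    (hh : h ∈ (⊥ : Ideal A).jacobson) : L h = 0 := by
  have hsq := apply_sq_eq_zero_of_mem_jacobson hL hsa hh
  have key : ∀ r : ℝ, 0 ≤ L 1 + 2 * r * L h := by
    intro r
    have h1 := hL (1 + r • h) ((IsSelfAdjoint.one A).add ((IsSelfAdjoint.all r).smul hsa))
    have h2 : (1 + r • h) ^ 2 = 1 + (2 * r) • h + r ^ 2 • h ^ 2 := by
      simp only [pow_two, add_mul, mul_add, one_mul, mul_one, smul_mul_smul_comm, two_mul, add_smul]
      abel
    rw [h2] at h1
    simpa [hsq] using h1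
  by_contra hne
  have h1 := key (-(L 1 + 1) / (2 * L h))
  have h2 : 2 * (-(L 1 + 1) / (2 * L h)) * L h = -(L 1 + 1) := by
    field_simp
  linarith

end RealFunctional

/-- Bisgaard: A positive linear functional on a unital complex *-algebra
vanishes on the Jacobson radical. -/
theorem stmt8 {A : Type*} [Ring A] [Algebra ℂ A] [StarRing A] [StarModule ℂ A]
    (φ : A →ₗ[ℂ] ℂ)
    (hpos : ∀ a : A, ∃ r : ℝ, 0 ≤ r ∧ φ (star a * a) = (r : ℂ))
    (a : A) (ha : a ∈ (⊥ : Ideal A).jacobson) :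
    φ a = 0 := by
  have him : ∀ h : A, IsSelfAdjoint h → (φ h).im = 0 := by
    intro h hh
    obtain ⟨r₁, -, h₁⟩ := hpos (1 + h)
    obtain ⟨r₂, -, h₂⟩ := hpos (1 - h)
    have h4 : star (1 + h) * (1 + h) - star (1 - h) * (1 - h) = (4 : ℂ) • h := by
      rw [star_add, star_sub, star_one, hh.star_eq, show (4 : ℂ) = 1 + 1 + 1 + 1 by norm_num]
      simp only [add_smul, one_smul]
      noncomm_ring
    have h5 := congrArg (fun x => (φ x).im) h4
    simp only [map_sub, h₁, h₂, map_smul, smul_eq_mul] at h5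
    simpa using h5.symm
  have hsa : ∀ h : A, IsSelfAdjoint h → h ∈ (⊥ : Ideal A).jacobson → φ h = 0 := by
    intro h hh hmem
    refine Complex.ext ?_ (him h hh)
    refine apply_eq_zero_of_isSelfAdjoint_of_mem_jacobson
      (L := Complex.reLm ∘ₗ φ.restrictScalars ℝ) (fun b hb => ?_) hh hmem
    obtain ⟨r, hr, hbr⟩ := hpos b
    rw [hb.star_eq, ← pow_two] at hbr
    simpa [hbr] using hr
  have hstar := Ideal.star_mem_jacobson_bot ha
  have smul_mem : ∀ (c : ℂ) {x : A}, x ∈ (⊥ : Ideal A).jacobson →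
      c • x ∈ (⊥ : Ideal A).jacobson := by
    intro c x hx
    rw [Algebra.smul_def]
    exact Ideal.mul_mem_left _ _ hx
  have h1 := hsa (a + star a) (IsSelfAdjoint.add_star_self a) (add_mem ha hstar)
  have h2 := hsa (Complex.I • (a - star a)) (by simp [IsSelfAdjoint, ← smul_neg])
    (smul_mem _ (sub_mem ha hstar))
  rw [map_smul, smul_eq_mul, mul_eq_zero, or_iff_right Complex.I_ne_zero, map_sub] at h2
  rw [map_add] at h1
  linear_combination (h1 + h2) / 2
end
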